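/- Let A be a commutative ring, let I be an ideal of A, and let M be a finitely generated faithful A-module. If x ∈ A satisfies x ∈ Iⁿ and x • M ⊆ I^{n+1}M for some n ≥ 0, then there exists k ≥ 1 such that xᵏ ∈ I^{nk+1}. (Claim in the proof of Proposition 3.8: for a faithful module M, the annihilator of the associated graded module G_I(M) in G_I(A) is nilpotent.) -/

import Mathlib

/-- For a finitely generated faithful module `M` over a commutative ring `A`:
if `x ∈ Iⁿ` and `x • M ⊆ I^{n+1}M`, then `xᵏ ∈ I^{nk+1}` for some `k ≥ 1`
(i.e. the annihilator of `G_I(M)` in `G_I(A)` is nilpotent). -/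
theorem stmt_2 {A M : Type*} [CommRing A] [AddCommGroup M] [Module A M]
    [Module.Finite A M] (hfaith : Module.annihilator A M = ⊥)
    (I : Ideal A) (x : A) (n : ℕ) (hx : x ∈ I ^ n)
    (hxM : ∀ m : M, x • m ∈ I ^ (n + 1) • (⊤ : Submodule A M)) :
    ∃ k ≥ 1, x ^ k ∈ I ^ (n * k + 1) := by
  obtain ⟨p, hp, -, hcoeff, hzero⟩ :=
    LinearMap.exists_monic_and_natDegree_eq_and_coeff_mem_pow_and_aeval_eq_zero A
      (algebraMap A (Module.End A M) x) (I ^ (n + 1)) (by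
        rintro _ ⟨m, rfl⟩
        exact hxM m)
  have hroot : p.eval x = 0 := by
    rw [Polynomial.aeval_algebraMap_apply, Polynomial.coe_aeval_eq_eval] at hzero
    rw [← Ideal.mem_bot, ← hfaith, Module.mem_annihilator]
    exact fun m ↦ LinearMap.congr_fun hzero m
  have hpow : x ^ p.natDegree ∈ I ^ (n * p.natDegree + 1) := by
    rw [Polynomial.eval_eq_sum_range, Finset.sum_range_succ, hp.coeff_natDegree, one_mul,
      add_comm] at hroot
    rw [eq_neg_of_add_eq_zero_left hroot]
    refine neg_mem (sum_mem fun i hi ↦ ?_)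
    obtain ⟨j, hj⟩ := Nat.exists_eq_add_of_lt (Finset.mem_range.mp hi)
    have hmem := Ideal.mul_mem_mul (hcoeff i) (Ideal.pow_mem_pow hx i)
    rw [← pow_mul, ← pow_mul, ← pow_add] at hmem
    refine Ideal.pow_le_pow_right ?_ hmem
    rw [hj, show i + j + 1 - i = j + 1 by omega]
    nlinarith
  refine ⟨p.natDegree + 1, Nat.le_add_left 1 _, ?_⟩
  have hmem := Ideal.mul_mem_mul hpow hx
  rwa [← pow_succ, ← pow_add, show n * p.natDegree + 1 + n = n * (p.natDegree + 1) + 1 by ring]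
    at hmem
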